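/- arXiv:1103.4956 — 3 statements merged into one kernel-verified Lean document; each statement's English description precedes it below -/
import Mathlib

section
/- Let n ≥ 1 and define F : (ℂ∖{0})^{n+1} → ℂ by F(u) = (u₁ + ⋯ + u_{n+1})·u₁⋯u_{n+1} + 1. A point u ∈ (ℂ∖{0})^{n+1} satisfies F(u) = 0 and ∂F/∂u_i(u) = 0 for all i = 2, …, n+1 if and only if u₂ = u₃ = ⋯ = u_{n+1} = −u₁/(n+1) and u₁^{n+2} = (−1)^{n+1}(n+1)^{n+1}. Consequently, the critical values of the projection u ↦ u₁ restricted to the hypersurface {u ∈ (ℂ∖{0})^{n+1} : F(u) = 0} are exactly the n+2 complex solutions of the equation z^{n+2} = (−1)^{n+1}(n+1)^{n+1}. -/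
open Finset

theorem deriv_aux (n : ℕ) (u : Fin (n + 1) → ℂ) (hu : ∀ i, u i ≠ 0) (i : Fin (n + 1)) :
    deriv (fun t : ℂ =>
      (∑ j, Function.update u i t j) * (∏ j, Function.update u i t j) + 1) (u i) = 0 ↔
      u i = -∑ j, u j := by
  have hS : ∑ j, u j = u i + ∑ j ∈ univ \ {i}, u j := by
    have := Finset.sum_update_of_mem (Finset.mem_univ i) u (u i)
    simpa using this
  have hQ : ∏ j ∈ univ \ {i}, u j ≠ 0 := Finset.prod_ne_zero_iff.mpr fun j _ => hu j
  have hf : (fun t : ℂ =>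
      (∑ j, Function.update u i t j) * (∏ j, Function.update u i t j) + 1) =
      fun t => (t + ∑ j ∈ univ \ {i}, u j) * (t * ∏ j ∈ univ \ {i}, u j) + 1 := by
    funext t
    rw [Finset.sum_update_of_mem (Finset.mem_univ i), Finset.prod_update_of_mem (Finset.mem_univ i)]
  rw [hf, hS]
  generalize (∑ j ∈ univ \ {i}, u j) = R at *
  generalize (∏ j ∈ univ \ {i}, u j) = Q at *
  have hd := ((((hasDerivAt_id (u i)).add_const R).mul
    ((hasDerivAt_id (u i)).mul_const Q)).add_const 1).deriv
  have hd' : deriv (fun t => (t + R) * (t * Q) + 1) (u i) = Q * (u i + (u i + R)) := by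
    refine Eq.trans hd ?_
    simp
    ring
  rw [hd', mul_eq_zero, or_iff_right hQ, eq_neg_iff_add_eq_zero]

theorem crit_aux (n : ℕ) (u : Fin (n + 1) → ℂ) (hu : ∀ i, u i ≠ 0) :
    (((∑ i, u i) * ∏ i, u i + 1 = 0 ∧
        ∀ i : Fin (n + 1), i ≠ 0 →
          deriv (fun t : ℂ =>
            (∑ j, Function.update u i t j) * (∏ j, Function.update u i t j) + 1) (u i) = 0) ↔
       ((∀ i : Fin (n + 1), i ≠ 0 → u i = -u 0 / ((n : ℂ) + 1)) ∧
        u 0 ^ (n + 2) = (-1 : ℂ) ^ (n + 1) * ((n : ℂ) + 1) ^ (n + 1))) := by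
  have hn1 : (n : ℂ) + 1 ≠ 0 := Nat.cast_add_one_ne_zero n
  have key : ∀ c : ℂ, (∀ i : Fin (n + 1), i ≠ 0 → u i = c) →
      ∑ i, u i = u 0 + n * c ∧ ∏ i, u i = u 0 * c ^ n := by
    intro c hc
    rw [Fin.sum_univ_succ, Fin.prod_univ_succ]
    simp [hc _ (Fin.succ_ne_zero _)]
  have hiff : (∀ i : Fin (n + 1), i ≠ 0 → u i = -∑ j, u j) ↔
      (∀ i : Fin (n + 1), i ≠ 0 → u i = -u 0 / ((n : ℂ) + 1)) := by
    constructor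
    · intro h i hi
      have h1 := (key _ h).1
      rw [h i hi, eq_div_iff hn1]
      linear_combination -h1
    · intro h i hi
      rw [(key _ h).1, h i hi]
      field_simp
      ring
  simp only [deriv_aux n u hu]
  rw [hiff, and_comm]
  refine and_congr_right fun h => ?_
  obtain ⟨h1, h2⟩ := key _ h
  have hs : (-1 : ℂ) ^ n * (-1) ^ n = 1 := by rw [← mul_pow]; simp
  have hS : (u 0 + n * (-u 0 / ((n : ℂ) + 1))) = u 0 / (n + 1) := by field_simp; ring
  have e : ((∑ i, u i) * ∏ i, u i + 1) * ((-1) ^ n * ((n : ℂ) + 1) ^ (n + 1)) =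
      u 0 ^ (n + 2) - (-1 : ℂ) ^ (n + 1) * ((n : ℂ) + 1) ^ (n + 1) := by
    rw [h1, h2, hS, div_pow, neg_pow]
    have : u 0 / ((n : ℂ) + 1) * (u 0 * ((-1) ^ n * u 0 ^ n / ((n : ℂ) + 1) ^ n)) *
        ((n : ℂ) + 1) ^ (n + 1) = (-1) ^ n * u 0 ^ (n + 2) := by
      field_simp
      ring
    linear_combination (-1) ^ n * this + u 0 ^ (n + 2) * hs
  have hne : ((-1) ^ n * ((n : ℂ) + 1) ^ (n + 1)) ≠ 0 :=
    mul_ne_zero (pow_ne_zero _ (by norm_num)) (pow_ne_zero _ hn1)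
  rw [← sub_eq_zero (a := u 0 ^ (n + 2)), ← e, mul_eq_zero, or_iff_left hne]

/-- Critical points and critical values of the projection `u ↦ u₁` on the
hypersurface `{(∑ uᵢ)·(∏ uᵢ) + 1 = 0}` in the torus `(ℂ∖{0})^{n+1}`. -/
theorem stmt0 (n : ℕ) (hn : 1 ≤ n) :
    (∀ u : Fin (n + 1) → ℂ, (∀ i, u i ≠ 0) →
      (((∑ i, u i) * ∏ i, u i + 1 = 0 ∧
        ∀ i : Fin (n + 1), i ≠ 0 →
          deriv (fun t : ℂ =>
            (∑ j, Function.update u i t j) * (∏ j, Function.update u i t j) + 1) (u i) = 0) ↔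
       ((∀ i : Fin (n + 1), i ≠ 0 → u i = -u 0 / ((n : ℂ) + 1)) ∧
        u 0 ^ (n + 2) = (-1 : ℂ) ^ (n + 1) * ((n : ℂ) + 1) ^ (n + 1)))) ∧
    {z : ℂ | ∃ u : Fin (n + 1) → ℂ, (∀ i, u i ≠ 0) ∧
        (∑ i, u i) * ∏ i, u i + 1 = 0 ∧
        (∀ i : Fin (n + 1), i ≠ 0 →
          deriv (fun t : ℂ =>
            (∑ j, Function.update u i t j) * (∏ j, Function.update u i t j) + 1) (u i) = 0) ∧
        u 0 = z} =
      {z : ℂ | z ^ (n + 2) = (-1 : ℂ) ^ (n + 1) * ((n : ℂ) + 1) ^ (n + 1)} := by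
  refine ⟨fun u hu => crit_aux n u hu, ?_⟩
  ext z
  simp only [Set.mem_ofPred_eq]
  constructor
  · rintro ⟨u, hu, h1, h2, rfl⟩
    exact ((crit_aux n u hu).1 ⟨h1, h2⟩).2
  · intro hz
    have hn1 : (n : ℂ) + 1 ≠ 0 := Nat.cast_add_one_ne_zero n
    have hz0 : z ≠ 0 := by
      rintro rfl
      rw [zero_pow (by omega)] at hz
      exact mul_ne_zero (pow_ne_zero _ (by norm_num)) (pow_ne_zero _ hn1) hz.symm
    let u : Fin (n + 1) → ℂ := fun i => if i = 0 then z else -z / ((n : ℂ) + 1)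
    have hu0 : u 0 = z := by simp [u]
    have hu : ∀ i, u i ≠ 0 := by
      intro i
      by_cases hi : i = 0
      · simp [u, hi, hz0]
      · simp only [u, hi, if_false]
        exact div_ne_zero (neg_ne_zero.mpr hz0) hn1
    have h := (crit_aux n u hu).2 ⟨fun i hi => by simp [u, hi], by rw [hu0]; exact hz⟩
    exact ⟨u, hu, h.1, h.2, hu0⟩
end

section
/- Let n ≥ 1 and define f : (ℝ_{>0})^n → ℝ by f(z₁, …, z_n) = (1 + z₁ + ⋯ + z_n)^{n+1} / (z₁⋯z_n). Then for every t ∈ ℝ the sublevel set {z ∈ (ℝ_{>0})^n : f(z) ≤ t} is a compact subset of ℝ^n, and for every t > (n+1)^{n+1} the level set {z ∈ (ℝ_{>0})^n : f(z) = t} is nonempty and compact. -/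
open Finset

/-- `f(z) = (1 + z₁ + ⋯ + z_n)^{n+1} / (z₁⋯z_n)` on the positive orthant. -/
noncomputable def pantsFun (n : ℕ) (z : Fin n → ℝ) : ℝ :=
  (1 + ∑ i, z i) ^ (n + 1) / ∏ i, z i

theorem pants_bound (n : ℕ) (t : ℝ) (z : Fin n → ℝ) (hz : ∀ i, 0 < z i)
    (h : (1 + ∑ i, z i) ^ (n + 1) ≤ t * ∏ i, z i) (i : Fin n) :
    0 < t ∧ 1 / t ≤ z i ∧ z i ≤ t := by
  obtain _ | m := n
  · exact i.elim0
  have hle : ∀ j, z j ≤ 1 + ∑ i, z i := fun j => by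
    have := Finset.single_le_sum (f := z) (fun i _ => (hz i).le) (Finset.mem_univ j)
    linarith
  have hs : 0 ≤ ∑ i, z i := Finset.sum_nonneg fun i _ => (hz i).le
  generalize hS : 1 + ∑ i, z i = S at *
  have hS1 : 1 ≤ S := by linarith
  have hP : 0 < ∏ i, z i := Finset.prod_pos fun i _ => hz i
  have ht : 0 < t := by
    have : 0 < t * ∏ i, z i := lt_of_lt_of_le (by positivity) h
    exact pos_of_mul_pos_left this hP.le
  have hPle : ∏ i, z i ≤ z i * S ^ m := by
    rw [← Finset.mul_prod_erase _ z (Finset.mem_univ i)]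
    refine mul_le_mul_of_nonneg_left ?_ (hz i).le
    calc _ ≤ ∏ _j ∈ Finset.univ.erase i, S :=
          Finset.prod_le_prod (fun j _ => (hz j).le) (fun j _ => hle j)
      _ = S ^ m := by simp
  have h2 : S ^ 2 ≤ t * z i := by
    have hm : 0 < S ^ m := by positivity
    refine le_of_mul_le_mul_right ?_ hm
    calc S ^ 2 * S ^ m = S ^ (m + 1 + 1) := by ring
      _ ≤ t * ∏ i, z i := h
      _ ≤ t * (z i * S ^ m) := mul_le_mul_of_nonneg_left hPle ht.le
      _ = _ := by ring
  have h3 := hle i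
  refine ⟨ht, ?_, ?_⟩
  · rw [div_le_iff₀ ht]; nlinarith
  · nlinarith [mul_le_mul_of_nonneg_left h3 ht.le]

/-- Every sublevel set of `f` on the positive orthant is compact, and for
`t > (n+1)^{n+1}` the level set of `f` at `t` is nonempty and compact. -/
theorem stmt4 (n : ℕ) (hn : 1 ≤ n) :
    (∀ t : ℝ, IsCompact {z : Fin n → ℝ | (∀ i, 0 < z i) ∧ pantsFun n z ≤ t}) ∧
    (∀ t : ℝ, ((n : ℝ) + 1) ^ (n + 1) < t →
      ({z : Fin n → ℝ | (∀ i, 0 < z i) ∧ pantsFun n z = t}).Nonempty ∧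
      IsCompact {z : Fin n → ℝ | (∀ i, 0 < z i) ∧ pantsFun n z = t}) := by
  have key : ∀ (t : ℝ) (s : Set (Fin n → ℝ)), IsClosed s →
      (∀ z ∈ s, (1 + ∑ i, z i) ^ (n + 1) ≤ t * ∏ i, z i) →
      IsCompact {z : Fin n → ℝ | (∀ i, 0 < z i) ∧ z ∈ s} := by
    intro t s hs hb
    by_cases ht : 0 < t
    · have : {z : Fin n → ℝ | (∀ i, 0 < z i) ∧ z ∈ s} =
          Set.Icc (fun _ => 1 / t) (fun _ => t) ∩ s := by
        ext z
        constructor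
        · rintro ⟨hz, h⟩
          exact ⟨⟨fun i => (pants_bound n t z hz (hb z h) i).2.1,
            fun i => (pants_bound n t z hz (hb z h) i).2.2⟩, h⟩
        · rintro ⟨⟨h1, _⟩, h⟩
          exact ⟨fun i => lt_of_lt_of_le (by positivity) (h1 i), h⟩
      rw [this]
      exact isCompact_Icc.inter_right hs
    · have : {z : Fin n → ℝ | (∀ i, 0 < z i) ∧ z ∈ s} = ∅ := by
        ext z
        simp only [Set.mem_setOf_eq, Set.mem_empty_iff_false, iff_false]
        rintro ⟨hz, h⟩
        exact ht (pants_bound n t z hz (hb z h) ⟨0, hn⟩).1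
      rw [this]
      exact isCompact_empty
  refine ⟨fun t => ?_, fun t ht => ⟨?_, ?_⟩⟩
  · convert key t {z | (1 + ∑ i, z i) ^ (n + 1) ≤ t * ∏ i, z i}
      (isClosed_le (by fun_prop) (by fun_prop)) (fun z hz => hz) using 1
    ext z
    refine and_congr_right fun hz => ?_
    exact div_le_iff₀ (Finset.prod_pos fun i _ => hz i)
  · have ht1 : 1 ≤ t := by
      have : (1 : ℝ) ≤ ((n : ℝ) + 1) ^ (n + 1) := one_le_pow₀ (by simp)
      linarith
    have hn' : (1 : ℝ) ≤ n := by exact_mod_cast hn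
    have hc : ContinuousOn (fun s : ℝ => (1 + n * s) ^ (n + 1) - t * s ^ n) (Set.Icc 1 t) := by
      fun_prop
    have hmem : (0 : ℝ) ∈ Set.Icc ((1 + n * (1 : ℝ)) ^ (n + 1) - t * 1 ^ n)
        ((1 + n * t) ^ (n + 1) - t * t ^ n) := by
      constructor
      · simp only [mul_one, one_pow]
        rw [add_comm]; linarith
      · have : t ^ (n + 1) ≤ (1 + n * t) ^ (n + 1) :=
          pow_le_pow_left₀ (by linarith) (by nlinarith) _
        rw [pow_succ'] at this
        linarith
    obtain ⟨s, hs, h0⟩ := intermediate_value_Icc ht1 hc hmem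
    have hs0 : 0 < s := by linarith [hs.1]
    refine ⟨fun _ => s, fun _ => hs0, ?_⟩
    simp only [pantsFun, Finset.sum_const, Finset.prod_const, Finset.card_univ, Fintype.card_fin,
      nsmul_eq_mul]
    rw [div_eq_iff (by positivity)]
    simp only at h0
    linarith
  · convert key t {z | (1 + ∑ i, z i) ^ (n + 1) = t * ∏ i, z i}
      (isClosed_eq (by fun_prop) (by fun_prop)) (fun z hz => le_of_eq hz) using 1
    ext z
    refine and_congr_right fun hz => ?_
    exact div_eq_iff (Finset.prod_pos fun i _ => hz i).ne'
end

section
/- Let n ≥ 0 and let S = {x ∈ (ℂ∖{0})^{n+2} : x₁⋯x_{n+2} = 1}. For x ∈ S, there exists λ ∈ ℂ such that (n+2)·x_i^{n+1} = λ·∏_{j≠i} x_j for all i = 1, …, n+2 if and only if x₁^{n+2} = x₂^{n+2} = ⋯ = x_{n+2}^{n+2}. The set of such points x ∈ S is finite with exactly (n+2)^{n+2} elements, and at each such point the value x₁^{n+2} + ⋯ + x_{n+2}^{n+2} belongs to {(n+2)·ζ : ζ ∈ ℂ, ζ^{n+2} = 1}. -/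
open Finset

lemma lag_iff (n : ℕ) (x : Fin (n + 2) → ℂ) (h0 : ∀ i, x i ≠ 0) (hp : (∏ i, x i) = 1) :
    ((∃ l : ℂ, ∀ i, ((n : ℂ) + 2) * x i ^ (n + 1) =
          l * ∏ j ∈ Finset.univ.erase i, x j) ↔
        ∀ i j, x i ^ (n + 2) = x j ^ (n + 2)) := by
  have hn : ((n : ℂ) + 2) ≠ 0 := by exact_mod_cast (by omega : n + 2 ≠ 0)
  have he : ∀ i, x i * ∏ j ∈ Finset.univ.erase i, x j = 1 := fun i => by
    rw [Finset.mul_prod_erase _ _ (Finset.mem_univ i), hp]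
  constructor
  · rintro ⟨l, hl⟩
    have key : ∀ i, ((n : ℂ) + 2) * x i ^ (n + 2) = l := fun i => by
      linear_combination x i * hl i + l * he i
    intro i j
    exact mul_left_cancel₀ hn ((key i).trans (key j).symm)
  · intro h
    refine ⟨((n : ℂ) + 2) * x 0 ^ (n + 2), fun i => ?_⟩
    apply mul_left_cancel₀ (h0 i)
    linear_combination ((n : ℂ) + 2) * h i 0 - ((n : ℂ) + 2) * x 0 ^ (n + 2) * he i

lemma card_roots (N : ℕ) (hN : 0 < N) (a : ℂ) (ha : a ≠ 0) :
    (Polynomial.nthRootsFinset N a).card = N := by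
  classical
  have hprim := Complex.isPrimitiveRoot_exp N hN.ne'
  obtain ⟨z, hz⟩ := IsAlgClosed.exists_pow_nat_eq a hN
  rw [Polynomial.nthRootsFinset_def, Multiset.toFinset_card_of_nodup (hprim.nthRoots_nodup ha),
    hprim.card_nthRoots, if_pos ⟨z, hz⟩]

lemma count_pts (n : ℕ) :
    Set.ncard {x : Fin (n + 2) → ℂ | (∀ i, x i ≠ 0) ∧ (∏ i, x i) = 1 ∧
        ∃ l : ℂ, ∀ i, ((n : ℂ) + 2) * x i ^ (n + 1) =
          l * ∏ j ∈ Finset.univ.erase i, x j} = (n + 2) ^ (n + 2) := by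
  classical
  have hN : 0 < n + 2 := by omega
  let P : Finset (Fin (n + 1) → ℂ) :=
    Fintype.piFinset fun _ => Polynomial.nthRootsFinset (n + 2) (1 : ℂ)
  let T : Finset (Σ _ : Fin (n + 1) → ℂ, ℂ) :=
    P.sigma fun z => Polynomial.nthRootsFinset (n + 2) (∏ i, z i)⁻¹
  let f : (Σ _ : Fin (n + 1) → ℂ, ℂ) → (Fin (n + 2) → ℂ) :=
    fun p => Fin.cons p.2 (fun i => p.2 * p.1 i)
  have hP : ∀ z, z ∈ P ↔ ∀ i, z i ^ (n + 2) = 1 := fun z => by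
    simp [P, Polynomial.mem_nthRootsFinset hN]
  have hPne : ∀ z ∈ P, ∀ i, z i ≠ 0 := fun z hz i h => by
    have := (hP z).1 hz i
    simp [h] at this
  have hPp : ∀ z ∈ P, (∏ i, z i) ≠ 0 := fun z hz =>
    Finset.prod_ne_zero_iff.2 fun i _ => hPne z hz i
  have hT : ∀ p, p ∈ T ↔ p.1 ∈ P ∧ p.2 ^ (n + 2) = (∏ i, p.1 i)⁻¹ := fun p => by
    simp [T, Polynomial.mem_nthRootsFinset hN]
  have hT0 : ∀ p ∈ T, p.2 ≠ 0 := fun p hp h => by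
    obtain ⟨h1, h2⟩ := (hT p).1 hp
    rw [h, zero_pow (by omega)] at h2
    exact inv_ne_zero (hPp _ h1) h2.symm
  have hcard : T.card = (n + 2) ^ (n + 2) := by
    rw [Finset.card_sigma, Finset.sum_congr rfl
      (fun z hz => card_roots (n + 2) hN _ (inv_ne_zero (hPp z hz)))]
    simp [P, card_roots (n + 2) hN 1 one_ne_zero, pow_succ]
  have hinj : Set.InjOn f (T : Set _) := by
    rintro ⟨z, a⟩ hp ⟨w, b⟩ hq hfe
    have ha := hT0 _ hp
    have hab : a = b := by simpa [f] using congrFun hfe 0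
    subst hab
    have : z = w := by
      funext i
      have := congrFun hfe i.succ
      simp only [f, Fin.cons_succ] at this
      exact mul_left_cancel₀ ha this
    rw [this]
  rw [← hcard, ← Set.ncard_coe_finset T, ← Set.ncard_image_of_injOn hinj]
  congr 1
  ext x
  simp only [Set.mem_setOf_eq, Set.mem_image, Finset.mem_coe]
  constructor
  · rintro ⟨h0, hp, hl⟩
    have he := (lag_iff n x h0 hp).1 hl
    refine ⟨⟨fun i => x i.succ / x 0, x 0⟩, (hT _).2 ⟨(hP _).2 fun i => ?_, ?_⟩, ?_⟩
    · rw [div_pow, he i.succ 0, div_self (pow_ne_zero _ (h0 0))]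
    · have h00 := h0 0
      rw [Fin.prod_univ_succ] at hp
      simp only [Finset.prod_div_distrib, Finset.prod_const, Finset.card_univ, Fintype.card_fin]
      rw [inv_div, eq_div_iff (right_ne_zero_of_mul (hp ▸ one_ne_zero))]
      linear_combination x 0 ^ (n + 1) * hp
    · funext i
      refine Fin.cases ?_ (fun i => ?_) i
      · simp [f]
      · simp [f, mul_div_cancel₀ _ (h0 0)]
  · rintro ⟨p, hp, rfl⟩
    have ha := hT0 _ hp
    obtain ⟨h1, h2⟩ := (hT p).1 hp
    have h0 : ∀ i, f p i ≠ 0 := fun i => by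
      refine Fin.cases ?_ (fun i => ?_) i
      · simpa [f] using ha
      · simpa [f, ha] using hPne _ h1 i
    have hpr : ∏ i, f p i = 1 := by
      rw [Fin.prod_univ_succ]
      simp only [f, Fin.cons_zero, Fin.cons_succ, Finset.prod_mul_distrib, Finset.prod_const,
        Finset.card_univ, Fintype.card_fin]
      rw [← mul_assoc, ← pow_succ', h2, inv_mul_cancel₀ (hPp _ h1)]
    refine ⟨h0, hpr, (lag_iff n _ h0 hpr).2 ?_⟩
    have key : ∀ i, f p i ^ (n + 2) = p.2 ^ (n + 2) := fun i => by
      refine Fin.cases ?_ (fun i => ?_) i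
      · simp [f]
      · simp [f, mul_pow, (hP _).1 h1 i]
    intro i j
    rw [key, key]

open Finset

/-- On the chart `S = {∏ xᵢ = 1}` of the big torus, the Lagrange-multiplier
condition `(n+2)xᵢ^{n+1} = λ·∏_{j≠i} xⱼ` holds for some `λ` iff all `xᵢ^{n+2}`
are equal; there are exactly `(n+2)^{n+2}` such points, and at each of them
`∑ xᵢ^{n+2} = (n+2)·ζ` for some `(n+2)`-nd root of unity `ζ`. -/
theorem stmt6 (n : ℕ) :
    (∀ x : Fin (n + 2) → ℂ, (∀ i, x i ≠ 0) → (∏ i, x i) = 1 →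
      ((∃ l : ℂ, ∀ i, ((n : ℂ) + 2) * x i ^ (n + 1) =
          l * ∏ j ∈ Finset.univ.erase i, x j) ↔
        ∀ i j, x i ^ (n + 2) = x j ^ (n + 2))) ∧
    Set.ncard {x : Fin (n + 2) → ℂ | (∀ i, x i ≠ 0) ∧ (∏ i, x i) = 1 ∧
        ∃ l : ℂ, ∀ i, ((n : ℂ) + 2) * x i ^ (n + 1) =
          l * ∏ j ∈ Finset.univ.erase i, x j} = (n + 2) ^ (n + 2) ∧
    ∀ x : Fin (n + 2) → ℂ, (∀ i, x i ≠ 0) → (∏ i, x i) = 1 →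
      (∃ l : ℂ, ∀ i, ((n : ℂ) + 2) * x i ^ (n + 1) =
          l * ∏ j ∈ Finset.univ.erase i, x j) →
      ∃ ζ : ℂ, ζ ^ (n + 2) = 1 ∧ (∑ i, x i ^ (n + 2)) = ((n : ℂ) + 2) * ζ := by
  refine ⟨lag_iff n, count_pts n, fun x h0 hp hl => ?_⟩
  have he := (lag_iff n x h0 hp).1 hl
  refine ⟨x 0 ^ (n + 2), ?_, ?_⟩
  · calc (x 0 ^ (n + 2)) ^ (n + 2) = ∏ i : Fin (n + 2), x i ^ (n + 2) := by
          rw [Finset.prod_congr rfl fun i _ => he i 0]; simp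
      _ = 1 := by rw [Finset.prod_pow, hp, one_pow]
  · rw [Finset.sum_congr rfl fun i _ => he i 0]; simp
end
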